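/- arXiv:2310.20124 — 6 statements merged into one kernel-verified Lean document; each statement's English description precedes it below -/
import Mathlib

section
/- Let E be a finite set of odd cardinality. Then the polar form b of q_E is nondegenerate on H_E (so q_E is a nonsingular quadratic form). Moreover, the number of vectors v ∈ H_E with q_E(v) = 1 exceeds the number of vectors with q_E(v) = 0 if and only if |E| ≡ 3 or 5 (mod 8) (i.e., writing |E| = 4m ± 1, the Arf invariant of q_E is m mod 2). -/
open Finset

abbrev F2 := ZMod 2

/-- `H_E`: the 𝔽₂-vector space of functions `v : E → 𝔽₂` with `∑ e, v e = 0`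
(characteristic functions of even-size subsets of `E`). -/
def HE (E : Type*) [Fintype E] : Submodule F2 (E → F2) where
  carrier := {v | ∑ e, v e = 0}
  zero_mem' := by simp
  add_mem' := by
    intro a b ha hb
    simp only [Set.mem_setOf_eq] at ha hb ⊢
    simp [Finset.sum_add_distrib, ha, hb]
  smul_mem' := by
    intro c v hv
    simp only [Set.mem_setOf_eq] at hv ⊢
    simp [← Finset.mul_sum, hv]

/-- The quadratic form `q_E`, determined by `q_E(χ_A) = (|A|/2) mod 2` for even-size `A`:
concretely, the number of 2-element subsets on which `v` is identically `1`, taken mod 2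
(for `v = χ_A` with `|A|` even this equals `(|A|/2) mod 2`). -/
def qE {E : Type*} [Fintype E] [DecidableEq E] (v : E → F2) : F2 :=
  (((Finset.univ : Finset E).powersetCard 2).filter (fun p => ∀ e ∈ p, v e = 1)).card

/-- The polar form `b(v,w) = q_E(v+w) - q_E(v) - q_E(w)` of `q_E`. -/
def bE {E : Type*} [Fintype E] [DecidableEq E] (v w : E → F2) : F2 :=
  qE (v + w) - qE v - qE w

section Support

variable {E : Type*}

theorem qE_eq_choose [Fintype E] [DecidableEq E] (v : E → F2) :
    qE v = ((#{e | v e = 1}).choose 2 : ℕ) := by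
  unfold qE
  rw [← Finset.card_powersetCard]
  congr 2
  ext p
  simp only [mem_filter, mem_powersetCard, subset_iff, mem_univ, true_and, implies_true]
  tauto

theorem F2_eq_zero_or_one (x : F2) : x = 0 ∨ x = 1 := by
  revert x; decide

theorem sum_eq_card_support [Fintype E] (v : E → F2) : ∑ e, v e = (#{e | v e = 1} : ℕ) := by
  rw [← Finset.sum_boole]
  refine Finset.sum_congr rfl fun e _ => ?_
  rcases F2_eq_zero_or_one (v e) with h | h <;> simp [h]

theorem mem_HE_iff [Fintype E] (v : E → F2) : v ∈ HE E ↔ Even #{e | v e = 1} := by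
  rw [← ZMod.natCast_eq_zero_iff_even, ← sum_eq_card_support]
  rfl

theorem qE_comp_perm [Fintype E] [DecidableEq E] (v : E → F2) (σ : Equiv.Perm E) :
    qE (v ∘ σ) = qE v := by
  rw [qE_eq_choose, qE_eq_choose]
  congr 2
  exact Finset.card_equiv σ (by simp)

theorem filter_single_add_single [Fintype E] [DecidableEq E] {e f : E} (hef : e ≠ f) :
    ({x | (Pi.single e 1 + Pi.single f 1 : E → F2) x = 1} : Finset E) = {e, f} := by
  ext x
  by_cases hxe : x = e
  · subst hxe; simp [hef]
  · by_cases hxf : x = f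
    · subst hxf; simp [hxe]
    · simp [hxe, hxf]

theorem add_single_add_single [DecidableEq E] {v : E → F2} {e f : E} (hv : v e ≠ v f) :
    v + (Pi.single e 1 + Pi.single f 1) = v ∘ Equiv.swap e f := by
  have hef : e ≠ f := fun h => hv (h ▸ rfl)
  have key : ∀ a b : F2, a ≠ b → a + 1 = b := by decide
  ext1 x
  by_cases hxe : x = e
  · subst hxe; simpa [hef] using key _ _ hv
  · by_cases hxf : x = f
    · subst hxf; simpa [hxe] using key _ _ hv.symm
    · simp [hxe, hxf, Equiv.swap_apply_of_ne_of_ne]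

theorem eq_zero_of_bE_eq_zero [Fintype E] [DecidableEq E] (hodd : Odd (Fintype.card E))
    {v : E → F2} (hv : v ∈ HE E)
    (h : ∀ w ∈ HE E, bE v w = 0) : v = 0 := by
  have hconst (e f : E) : v e = v f := by
    by_contra hne
    have hef : e ≠ f := fun h => hne (h ▸ rfl)
    have hcard := congrArg Finset.card (filter_single_add_single hef)
    rw [Finset.card_pair hef] at hcard
    have hb := h _ ((mem_HE_iff _).2 (hcard ▸ even_two))
    rw [bE, add_single_add_single hne, qE_comp_perm, qE_eq_choose (_ + _), hcard] at hb
    simp at hb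
  ext1 e
  have hsum : ∑ x, v x = 0 := hv
  rw [Finset.sum_congr rfl fun x _ => hconst x e] at hsum
  simpa [ZMod.natCast_eq_one_iff_odd.2 hodd] using hsum

end Support

section Counting

/-- The imaginary unit of the Gaussian integers. -/
def gaussianI : GaussianInt := ⟨0, 1⟩

theorem re_gaussianI_pow (k : ℕ) :
    (gaussianI ^ k).re =
      (if Even k ∧ ((k.choose 2 : ℕ) : F2) = 0 then 1 else 0) -
        (if Even k ∧ ((k.choose 2 : ℕ) : F2) = 1 then 1 else 0) := by
  rcases Nat.even_or_odd' k with ⟨m, rfl | rfl⟩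
  · have hI : gaussianI ^ 2 = -1 := by decide
    have hchoose : (((2 * m).choose 2 : ℕ) : F2) = m := by
      have : (2 * m).choose 2 = m * (2 * m - 1) := by
        rw [Nat.choose_two_right, mul_assoc, Nat.mul_div_cancel_left _ two_pos]
      rw [this]
      rcases m with _ | m
      · simp
      · rw [show 2 * (m + 1) - 1 = 2 * m + 1 by omega]
        have h2 : (2 : F2) = 0 := rfl
        push_cast
        rw [h2]
        ring
    rw [pow_mul, hI, hchoose]
    rcases Nat.even_or_odd m with hm | hm
    · simp [hm.neg_one_pow, ZMod.natCast_eq_zero_iff_even.2 hm]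
    · simp [hm.neg_one_pow, ZMod.natCast_eq_one_iff_odd.2 hm]
  · have hI : gaussianI ^ 2 = -1 := by decide
    have hodd : ¬ Even (2 * m + 1) := by simp
    rw [pow_succ, pow_mul, hI]
    rcases neg_one_pow_eq_or GaussianInt m with hm | hm <;> simp [hm, hodd, gaussianI]

theorem card_sub_card_eq_re (E : Type*) [Fintype E] [DecidableEq E] :
    (Nat.card {v : E → F2 // v ∈ HE E ∧ qE v = 0} : ℤ) -
        Nat.card {v : E → F2 // v ∈ HE E ∧ qE v = 1} =
      ((1 + gaussianI) ^ Fintype.card E).re := by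
  have hpow : (1 + gaussianI) ^ Fintype.card E =
      ∑ v : E → F2, gaussianI ^ #{e | v e = 1} := by
    have hsum : ∑ x : F2, (if x = 1 then gaussianI else 1) = 1 + gaussianI := by decide
    have := Finset.prod_univ_sum (fun _ : E => (Finset.univ : Finset F2))
      (fun _ x => if x = 1 then gaussianI else 1)
    simp only [hsum, Finset.prod_const, Finset.card_univ, Fintype.piFinset_univ] at this
    rw [this]
    refine Finset.sum_congr rfl fun v _ => ?_
    simp [Finset.prod_ite]
  have hre (s : Finset (E → F2)) (g : (E → F2) → GaussianInt) :
      (∑ v ∈ s, g v).re = ∑ v ∈ s, (g v).re := by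
    induction s using Finset.induction_on with
    | empty => simp
    | insert a s ha ih => simp [Finset.sum_insert ha, ih]
  classical
  rw [hpow, hre]
  simp only [re_gaussianI_pow, ← qE_eq_choose, ← mem_HE_iff, Finset.sum_sub_distrib,
    Finset.sum_boole, Nat.card_eq_fintype_card, Fintype.card_subtype]

theorem re_one_add_gaussianI_pow_neg_iff {n : ℕ} (hn : n % 2 = 1) :
    ((1 + gaussianI) ^ n).re < 0 ↔ n % 8 = 3 ∨ n % 8 = 5 := by
  have h8 : (1 + gaussianI) ^ 8 = ((16 : ℤ) : GaussianInt) := by decide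
  have hre : ((1 + gaussianI) ^ n).re = 16 ^ (n / 8) * ((1 + gaussianI) ^ (n % 8)).re := by
    conv_lhs => rw [← Nat.div_add_mod n 8, pow_add, pow_mul, h8, ← Int.cast_pow, Zsqrtd.re_smul]
  have hpos : (0 : ℤ) < 16 ^ (n / 8) := by positivity
  rw [hre, ← not_le, mul_nonneg_iff_of_pos_left hpos, not_le]
  have hlt : n % 8 < 8 := Nat.mod_lt _ (by norm_num)
  have hodd : n % 8 % 2 = 1 := by omega
  generalize n % 8 = r at *
  interval_cases r <;> first | omega | decide

end Counting

/-- For `|E|` odd, the polar form of `q_E` is nondegenerate on `H_E`, and `q_E` takes the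
value `1` more often than `0` on `H_E` iff `|E| ≡ 3, 5 (mod 8)` (Arf invariant `m mod 2`
for `|E| = 4m ± 1`). -/
theorem statement0 (E : Type*) [Fintype E] [DecidableEq E]
    (hodd : Fintype.card E % 2 = 1) :
    (∀ v : E → F2, v ∈ HE E → (∀ w : E → F2, w ∈ HE E → bE v w = 0) → v = 0) ∧
    (Nat.card {v : E → F2 // v ∈ HE E ∧ qE v = 1} >
        Nat.card {v : E → F2 // v ∈ HE E ∧ qE v = 0} ↔
      (Fintype.card E % 8 = 3 ∨ Fintype.card E % 8 = 5)) := by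
  refine ⟨fun v hv h => eq_zero_of_bE_eq_zero (Nat.odd_iff.2 hodd) hv h, ?_⟩
  rw [← re_one_add_gaussianI_pow_neg_iff hodd, ← card_sub_card_eq_re, sub_neg, Nat.cast_lt]
end

section
/- Let (V, q) be a nonsingular quadratic 𝔽₂-vector space of finite dimension and let r₁, …, r_t ≥ 1 be integers. Let B = (B_{s,j}) and B' = (B'_{s,j}), for 1 ≤ s ≤ t and 1 ≤ j ≤ r_s, be two partial bases of V of type A_{r₁} + ⋯ + A_{r_t}: each is a linearly independent family of roots such that for each s the tuple (B_{s,1}, …, B_{s,r_s}) is an A_{r_s}-chain and the polar form vanishes between members of different chains (and likewise for B'). If r₁ + ⋯ + r_t < (dim V)/2, then there exists σ ∈ O(V, q) with σ(B_{s,j}) = B'_{s,j} for all s, j. -/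
open Finset

open QuadraticMap in
/-- A linear endomorphism preserving a nonsingular quadratic form is an automorphism. -/
theorem exists_linearEquiv_of_map_eq {V : Type*} [AddCommGroup V] [Module F2 V]
    [FiniteDimensional F2 V] (q : QuadraticForm F2 V)
    (hnd : ∀ v : V, (∀ w : V, polar (⇑q) v w = 0) → v = 0)
    (f : V →ₗ[F2] V) (hf : ∀ v, q (f v) = q v) :
    ∃ τ : V ≃ₗ[F2] V, ∀ v, τ v = f v := by
  have hinj : Function.Injective f := by
    rw [← LinearMap.ker_eq_bot, LinearMap.ker_eq_bot']
    refine fun v hv => hnd v fun w => ?_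
    have h : polar (⇑q) (f v) (f w) = polar (⇑q) v w := by
      simp only [polar, ← map_add, hf]
    rw [← h, hv, polar_zero_left]
  exact ⟨LinearEquiv.ofInjectiveEndo f hinj, fun v => rfl⟩

open QuadraticMap in
/-- The transvection in a root `u`. -/
theorem exists_transvection {V : Type*} [AddCommGroup V] [Module F2 V]
    [FiniteDimensional F2 V] (q : QuadraticForm F2 V)
    (hnd : ∀ v : V, (∀ w : V, polar (⇑q) v w = 0) → v = 0) (u : V) (hu : q u = 1) :
    ∃ τ : V ≃ₗ[F2] V, (∀ v, q (τ v) = q v) ∧ ∀ v, τ v = v + polar (⇑q) u v • u := by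
  let f : V →ₗ[F2] V := LinearMap.id + (q.polarBilin u).smulRight u
  have hfv (v : V) : f v = v + polar (⇑q) u v • u := rfl
  have hf (v : V) : q (f v) = q v := by
    rw [hfv, QuadraticMap.map_add q, QuadraticMap.map_smul, polar_smul_right, hu, polar_comm q v u]
    simp only [smul_eq_mul]
    generalize q v = a
    generalize polar (⇑q) u v = b
    revert a b
    decide
  obtain ⟨τ, hτ⟩ := exists_linearEquiv_of_map_eq q hnd f hf
  exact ⟨τ, fun v => by rw [hτ, hf], hτ⟩

open QuadraticMap in
/-- The Siegel transformation attached to a singular vector `u` and a vector `w` orthogonal to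
`u`. -/
theorem exists_siegel_transformation {V : Type*} [AddCommGroup V] [Module F2 V]
    [FiniteDimensional F2 V] (q : QuadraticForm F2 V)
    (hnd : ∀ v : V, (∀ w : V, polar (⇑q) v w = 0) → v = 0) (u w : V) (hu : q u = 0)
    (huw : polar (⇑q) w u = 0) :
    ∃ τ : V ≃ₗ[F2] V, (∀ v, q (τ v) = q v) ∧
      ∀ v, τ v = v + (polar (⇑q) u v • w + (polar (⇑q) w v + q w * polar (⇑q) u v) • u) := by
  let f : V →ₗ[F2] V := LinearMap.id + ((q.polarBilin u).smulRight w +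
    (q.polarBilin w + q w • q.polarBilin u).smulRight u)
  have hfv (v : V) : f v = v + (polar (⇑q) u v • w +
    (polar (⇑q) w v + q w * polar (⇑q) u v) • u) := rfl
  have hf (v : V) : q (f v) = q v := by
    rw [hfv]
    simp only [QuadraticMap.map_add q, QuadraticMap.map_smul, polar_smul_right, polar_smul_left,
      polar_add_right, hu, huw, polar_comm q v u, polar_comm q v w, smul_eq_mul]
    generalize q v = a
    generalize q w = b
    generalize polar (⇑q) u v = c
    generalize polar (⇑q) w v = d
    revert a b c d
    decide
  obtain ⟨τ, hτ⟩ := exists_linearEquiv_of_map_eq q hnd f hf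
  exact ⟨τ, fun v => by rw [hτ, hf], hτ⟩

open QuadraticMap in
/-- In a nonsingular space, every vector outside a subspace `K` is separated from `K` by the
polar form. -/
theorem exists_polar_eq_one_of_notMem {V : Type*} [AddCommGroup V] [Module F2 V]
    [FiniteDimensional F2 V] (q : QuadraticForm F2 V)
    (hnd : ∀ v : V, (∀ w : V, polar (⇑q) v w = 0) → v = 0) (K : Submodule F2 V) (x : V)
    (hx : x ∉ K) : ∃ w : V, polar (⇑q) w x = 1 ∧ ∀ k ∈ K, polar (⇑q) w k = 0 := by
  obtain ⟨g, hgx, hg⟩ := Submodule.exists_le_ker_of_notMem hx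
  have hinj : Function.Injective q.polarBilin := by
    rw [← LinearMap.ker_eq_bot, LinearMap.ker_eq_bot']
    exact fun v hv => hnd v fun w => LinearMap.congr_fun hv w
  obtain ⟨w, hw⟩ := (LinearMap.injective_iff_surjective_of_finrank_eq_finrank
    (Subspace.dual_finrank_eq (K := F2) (V := V)).symm).1 hinj g
  have hwv (v : V) : polar (⇑q) w v = g v := LinearMap.congr_fun hw v
  refine ⟨w, ?_, fun k hk => ?_⟩
  · rw [hwv]
    exact Fin.eq_one_of_ne_zero _ hgx
  · rw [hwv]
    exact hg hk

open QuadraticMap in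
/-- Two vectors outside a subspace `H` with the same norm and the same polar products with `H` are
conjugate under the pointwise stabilizer of `H` in the orthogonal group. -/
theorem exists_isometry_fixing_submodule {V : Type*} [AddCommGroup V] [Module F2 V]
    [FiniteDimensional F2 V] (q : QuadraticForm F2 V)
    (hnd : ∀ v : V, (∀ w : V, polar (⇑q) v w = 0) → v = 0) (H : Submodule F2 V) (x y : V)
    (hx : x ∉ H) (hy : y ∉ H) (hxy : q x = q y)
    (hH : ∀ h ∈ H, polar (⇑q) x h = polar (⇑q) y h) :
    ∃ τ : V ≃ₗ[F2] V, (∀ v, q (τ v) = q v) ∧ (∀ h ∈ H, τ h = h) ∧ τ x = y := by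
  have hadd (a : V) : a + a = 0 := by
    rw [← two_smul F2 a, show (2 : F2) = 0 from rfl, zero_smul]
  have hxu : x + (x + y) = y := by rw [← add_assoc, hadd, zero_add]
  have hself : polar (⇑q) x x = 0 := by
    rw [polar_self, two_smul]
    exact CharTwo.add_self_eq_zero _
  have hqu : q (x + y) = polar (⇑q) (x + y) x := by
    rw [QuadraticMap.map_add q, hxy, CharTwo.add_self_eq_zero, zero_add, polar_add_left, hself,
      zero_add, polar_comm]
  have huH : ∀ h ∈ H, polar (⇑q) (x + y) h = 0 := fun h hh => by
    rw [polar_add_left, hH h hh, CharTwo.add_self_eq_zero]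
  by_cases hu : q (x + y) = 0
  · have hxK : x ∉ H ⊔ Submodule.span F2 {x + y} := by
      rw [Submodule.mem_sup]
      rintro ⟨h, hh, z, hz, hhz⟩
      obtain ⟨c, rfl⟩ := Submodule.mem_span_singleton.1 hz
      by_cases hc : c = 0
      · rw [hc, zero_smul, add_zero] at hhz
        exact hx (hhz ▸ hh)
      · rw [show c = 1 from Fin.eq_one_of_ne_zero _ hc, one_smul] at hhz
        have hyh : y = h := by
          calc y = x + (x + y) := hxu.symm
            _ = h + (x + y) + (x + y) := by rw [hhz]
            _ = h := by rw [add_assoc, hadd, add_zero]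
        exact hy (hyh ▸ hh)
    obtain ⟨w, hwx, hw⟩ := exists_polar_eq_one_of_notMem q hnd _ x hxK
    have hwu := hw _ (Submodule.mem_sup_right (Submodule.mem_span_singleton_self (x + y)))
    obtain ⟨τ, hτq, hτ⟩ := exists_siegel_transformation q hnd (x + y) w hu hwu
    refine ⟨τ, hτq, fun h hh => ?_, ?_⟩
    · rw [hτ, huH h hh, hw h (Submodule.mem_sup_left hh)]
      simp
    · rw [hτ, ← hqu, hu, hwx, zero_smul, zero_add, mul_zero, add_zero, one_smul, hxu]
  · have hu1 : q (x + y) = 1 := Fin.eq_one_of_ne_zero _ hu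
    obtain ⟨τ, hτq, hτ⟩ := exists_transvection q hnd (x + y) hu1
    refine ⟨τ, hτq, fun h hh => ?_, ?_⟩
    · rw [hτ, huH h hh, zero_smul, add_zero]
    · rw [hτ, ← hqu, hu1, one_smul, hxu]

open QuadraticMap in
/-- Witt's extension theorem over `𝔽₂`, for linearly independent families. -/
theorem exists_isometry_of_linearIndependent {V : Type*} [AddCommGroup V] [Module F2 V]
    [FiniteDimensional F2 V] (q : QuadraticForm F2 V)
    (hnd : ∀ v : V, (∀ w : V, polar (⇑q) v w = 0) → v = 0)
    {ι : Type*} (B B' : ι → V) (hB : LinearIndependent F2 B) (hB' : LinearIndependent F2 B')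
    (hq : ∀ i, q (B i) = q (B' i))
    (hpolar : ∀ i j, i ≠ j → polar (⇑q) (B i) (B j) = polar (⇑q) (B' i) (B' j)) (s : Finset ι) :
    ∃ σ : V ≃ₗ[F2] V, (∀ x, q (σ x) = q x) ∧ ∀ i ∈ s, σ (B i) = B' i := by
  classical
  induction s using Finset.induction_on with
  | empty => exact ⟨LinearEquiv.refl F2 V, fun _ => rfl, by simp⟩
  | insert a s ha ih =>
    obtain ⟨σ, hσq, hσ⟩ := ih
    have ha' : a ∉ (s : Set ι) := ha
    have hx : σ (B a) ∉ Submodule.span F2 (B' '' s) := by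
      have himg : B' '' s = (σ ∘ B) '' s := Set.image_congr fun i hi => (hσ i hi).symm
      rw [himg]
      exact (hB.map' σ.toLinearMap σ.ker).notMem_span_image ha'
    have hH : ∀ h ∈ Submodule.span F2 (B' '' s),
        polar (⇑q) (σ (B a)) h = polar (⇑q) (B' a) h := by
      intro h hh
      refine LinearMap.eqOn_span (f := q.polarBilin (σ (B a))) (g := q.polarBilin (B' a)) ?_ hh
      rintro _ ⟨i, hi, rfl⟩
      have hai : a ≠ i := fun e => ha (e ▸ hi)
      change polar (⇑q) (σ (B a)) (B' i) = polar (⇑q) (B' a) (B' i)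
      rw [← hpolar a i hai, ← hσ i hi]
      simp only [polar, ← map_add, hσq]
    obtain ⟨τ, hτq, hτH, hτx⟩ := exists_isometry_fixing_submodule q hnd _ (σ (B a)) (B' a) hx
      (hB'.notMem_span_image ha') (by rw [hσq, hq]) hH
    refine ⟨σ.trans τ, fun v => by rw [LinearEquiv.trans_apply, hτq, hσq], fun i hi => ?_⟩
    rw [LinearEquiv.trans_apply]
    rcases Finset.mem_insert.1 hi with rfl | hi
    · exact hτx
    · rw [hσ i hi]
      exact hτH _ (Submodule.subset_span ⟨i, hi, rfl⟩)

/-- in a nonsingular finite-dimensional quadratic 𝔽₂-space, any two partial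
bases of the same type `A_{r₁} + ⋯ + A_{r_t}` of total size `< (dim V)/2` are
`O(V,q)`-equivalent. -/
theorem statement3 (V : Type*) [AddCommGroup V] [Module F2 V] [FiniteDimensional F2 V]
    (q : QuadraticForm F2 V)
    (hnd : ∀ v : V, (∀ w : V, QuadraticMap.polar (⇑q) v w = 0) → v = 0)
    (t : ℕ) (r : Fin t → ℕ) (hr : ∀ s, 1 ≤ r s)
    (B B' : (Σ s : Fin t, Fin (r s)) → V)
    (hBli : LinearIndependent F2 B) (hB'li : LinearIndependent F2 B')
    (hBroot : ∀ i, q (B i) = 1) (hB'root : ∀ i, q (B' i) = 1)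
    (hBpolar : ∀ i j : (Σ s : Fin t, Fin (r s)), i ≠ j →
      QuadraticMap.polar (⇑q) (B i) (B j) =
        if i.1 = j.1 ∧ ((i.2 : ℕ) + 1 = (j.2 : ℕ) ∨ (j.2 : ℕ) + 1 = (i.2 : ℕ))
          then 1 else 0)
    (hB'polar : ∀ i j : (Σ s : Fin t, Fin (r s)), i ≠ j →
      QuadraticMap.polar (⇑q) (B' i) (B' j) =
        if i.1 = j.1 ∧ ((i.2 : ℕ) + 1 = (j.2 : ℕ) ∨ (j.2 : ℕ) + 1 = (i.2 : ℕ))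
          then 1 else 0)
    (hsize : 2 * (∑ s, r s) < Module.finrank F2 V) :
    ∃ σ : V ≃ₗ[F2] V, (∀ x, q (σ x) = q x) ∧ ∀ i, σ (B i) = B' i := by
  obtain ⟨σ, hσq, hσ⟩ := exists_isometry_of_linearIndependent q hnd B B' hBli hB'li
    (fun i => by rw [hBroot, hB'root]) (fun i j h => by rw [hBpolar i j h, hB'polar i j h])
    Finset.univ
  exact ⟨σ, hσq, fun i => hσ i (Finset.mem_univ i)⟩
end

section
/- Let (V, q) be a nonsingular quadratic 𝔽₂-vector space of finite dimension and let a ∈ V be a root. Set a^⊥ := {x ∈ V : b(x,a) = 0} (which contains a, since b is alternating) and Q := a^⊥/⟨a⟩. Then the polar form b induces a nondegenerate alternating bilinear form b̄ on Q; every g ∈ O(V, q) with g(a) = a preserves a^⊥ and induces an automorphism ḡ of Q preserving b̄; and the resulting group homomorphism from the stabilizer O(V, q)_a to the symplectic group Sp(Q, b̄) is surjective with kernel {id_V, σ_a}, where σ_a is the orthogonal reflection in a. -/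
variable {V : Type*} [AddCommGroup V] [Module F2 V]

/-- `a^⊥ = {x : V | polar q x a = 0}`. -/
def aperp (q : QuadraticForm F2 V) (a : V) : Submodule F2 V where
  carrier := {x | QuadraticMap.polar (⇑q) x a = 0}
  zero_mem' := by
    simp [QuadraticMap.polar]
  add_mem' := by
    intro x y hx hy
    simp only [Set.mem_setOf_eq] at hx hy ⊢
    rw [QuadraticMap.polar_add_left, hx, hy, add_zero]
  smul_mem' := by
    intro c x hx
    simp only [Set.mem_setOf_eq] at hx ⊢
    rw [QuadraticMap.polar_smul_left, hx, smul_zero]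

lemma self_mem_aperp (q : QuadraticForm F2 V) (a : V) : a ∈ aperp q a := by
  show QuadraticMap.polar (⇑q) a a = 0
  rw [QuadraticMap.polar_self]
  rw [two_nsmul]
  exact CharTwo.add_self_eq_zero _

/-- The line spanned by `a` inside `a^⊥`. -/
def lineA (q : QuadraticForm F2 V) (a : V) : Submodule F2 ↥(aperp q a) :=
  Submodule.span F2 {(⟨a, self_mem_aperp q a⟩ : ↥(aperp q a))}

/-- `Q = a^⊥ / ⟨a⟩`. -/
abbrev QuotA (q : QuadraticForm F2 V) (a : V) := ↥(aperp q a) ⧸ lineA q a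

open QuadraticMap

lemma F2.eq_zero_or_one (t : F2) : t = 0 ∨ t = 1 := by
  revert t; decide

/-- The nontrivial character of `𝔽₂`, with values in `ℤ`. -/
def signChar (t : F2) : ℤ := if t = 0 then 1 else -1

lemma signChar_add (s t : F2) : signChar (s + t) = signChar s * signChar t := by
  revert s t; decide

lemma mem_aperp {q : QuadraticForm F2 V} {a x : V} : x ∈ aperp q a ↔ polar q x a = 0 := Iff.rfl

lemma map_add_eq (q : QuadraticForm F2 V) (x y : V) : q (x + y) = q x + q y + polar q x y := by
  simp [polar]

lemma polar_self_eq_zero (q : QuadraticForm F2 V) (x : V) : polar q x x = 0 :=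
  self_mem_aperp q x

lemma add_self_eq_zero_of_F2 (x : V) : x + x = 0 := by
  rw [← two_smul F2 x, show (2 : F2) = 0 from rfl, zero_smul]

lemma map_add_root {q : QuadraticForm F2 V} {a x : V} (ha : q a = 1) (hx : x ∈ aperp q a) :
    q (x + a) = q x + 1 := by
  rw [map_add_eq, ha, mem_aperp.1 hx, add_zero]

lemma polar_map {q : QuadraticForm F2 V} {g : V → V} (hadd : ∀ x y, g (x + y) = g x + g y)
    (hg : ∀ x, q (g x) = q x) (x y : V) : polar q (g x) (g y) = polar q x y := by
  simp only [polar, ← hadd, hg]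

lemma map_mem_aperp {q : QuadraticForm F2 V} {a : V} {g : V ≃ₗ[F2] V} (hg : ∀ x, q (g x) = q x)
    (hga : g a = a) {x : V} (hx : x ∈ aperp q a) : g x ∈ aperp q a := by
  have h := polar_map (map_add g) hg x a
  rw [hga] at h
  exact h.trans hx

lemma mem_lineA {q : QuadraticForm F2 V} {a : V} {x : aperp q a} :
    x ∈ lineA q a ↔ (x : V) = 0 ∨ (x : V) = a := by
  rw [lineA, Submodule.mem_span_singleton]
  constructor
  · rintro ⟨c, rfl⟩
    rcases F2.eq_zero_or_one c with rfl | rfl <;> simp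
  · rintro (h | h)
    · exact ⟨0, by ext; simp [h]⟩
    · exact ⟨1, by ext; simp [h]⟩

lemma mk_eq_mk_iff {q : QuadraticForm F2 V} {a : V} {x y : aperp q a} :
    (Submodule.Quotient.mk x : QuotA q a) = Submodule.Quotient.mk y ↔
      (x : V) = y ∨ (x : V) = y + a := by
  rw [Submodule.Quotient.eq, mem_lineA, Submodule.coe_sub, sub_eq_zero, sub_eq_iff_eq_add']

/-- On `a^⊥`, a vector is determined by its class in `a^⊥ / ⟨a⟩` and its value under `q`. -/
lemma eq_of_mk_eq {q : QuadraticForm F2 V} {a : V} (ha : q a = 1) {x y : aperp q a}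
    (h : (Submodule.Quotient.mk x : QuotA q a) = Submodule.Quotient.mk y)
    (hq : q (x : V) = q (y : V)) : x = y := by
  rcases mk_eq_mk_iff.1 h with h | h
  · exact Subtype.ext h
  · rw [h, map_add_root ha y.2] at hq
    simp at hq

lemma exists_mk_eq {q : QuadraticForm F2 V} {a : V} (ha : q a = 1) (u : QuotA q a) (t : F2) :
    ∃ y : aperp q a, (Submodule.Quotient.mk y : QuotA q a) = u ∧ q (y : V) = t := by
  obtain ⟨y, rfl⟩ := Submodule.Quotient.mk_surjective _ u
  by_cases h : q (y : V) = t
  · exact ⟨y, rfl, h⟩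
  · refine ⟨y + ⟨a, self_mem_aperp q a⟩, mk_eq_mk_iff.2 (Or.inr rfl), ?_⟩
    have h1 : q ((y : V) + a) = q (y : V) + 1 := map_add_root ha y.2
    refine h1.trans ?_
    revert h
    generalize q (y : V) = s
    revert s t
    decide

lemma exists_polar_eq_one {q : QuadraticForm F2 V}
    (hnd : ∀ v : V, (∀ w : V, polar q v w = 0) → v = 0) {a : V} (ha : a ≠ 0) :
    ∃ e : V, polar q e a = 1 := by
  by_contra! h
  refine ha (hnd a fun w => ?_)
  rw [polar_comm]
  exact (F2.eq_zero_or_one _).resolve_right (h w)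

lemma add_smul_mem_aperp {q : QuadraticForm F2 V} {a e : V} (he : polar q e a = 1) (v : V) :
    v + polar q v a • e ∈ aperp q a := by
  rw [mem_aperp, polar_add_left, polar_smul_left, he, smul_eq_mul, mul_one]
  exact CharTwo.add_self_eq_zero _

lemma add_smul_add_smul (v e : V) (c : F2) : v + c • e + c • e = v := by
  rw [add_assoc, add_self_eq_zero_of_F2, add_zero]

/-- For nonsingular `q`, the orthogonal of `a^⊥` is the line `⟨a⟩`. -/
lemma eq_smul_of_polar_aperp {q : QuadraticForm F2 V}
    (hnd : ∀ v : V, (∀ w : V, polar q v w = 0) → v = 0) {a e : V} (he : polar q e a = 1)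
    {z : V} (hz : ∀ x ∈ aperp q a, polar q z x = 0) : z = polar q z e • a := by
  rw [← sub_eq_zero]
  refine hnd _ fun w => ?_
  have hw := hz _ (add_smul_mem_aperp he w)
  rw [polar_add_right, polar_smul_right] at hw
  rw [polar_sub_left, polar_smul_left, polar_comm q a w]
  simp only [smul_eq_mul] at hw ⊢
  rw [CharTwo.sub_eq_add, mul_comm, hw]

/-- The restriction to `a^⊥` of an isometry fixing `a`. -/
def aperpEquiv (q : QuadraticForm F2 V) (a : V) (g : V ≃ₗ[F2] V) (hg : ∀ x, q (g x) = q x)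
    (hga : g a = a) : aperp q a ≃ₗ[F2] aperp q a :=
  g.ofSubmodules (aperp q a) (aperp q a) <| by
    refine le_antisymm ?_ ?_
    · rintro _ ⟨x, hx, rfl⟩
      exact map_mem_aperp hg hga hx
    · intro y hy
      refine ⟨g.symm y, ?_, g.apply_symm_apply y⟩
      refine map_mem_aperp (fun x => ?_) ?_ hy
      · rw [← hg (g.symm x), g.apply_symm_apply]
      · rw [LinearEquiv.symm_apply_eq, hga]

/-- The automorphism of `a^⊥ / ⟨a⟩` induced by an isometry fixing `a`. -/
def quotEquiv (q : QuadraticForm F2 V) (a : V) (g : V ≃ₗ[F2] V) (hg : ∀ x, q (g x) = q x)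
    (hga : g a = a) : QuotA q a ≃ₗ[F2] QuotA q a :=
  Submodule.Quotient.equiv (lineA q a) (lineA q a) (aperpEquiv q a g hg hga) <| by
    rw [lineA, Submodule.map_span, Set.image_singleton]
    congr 2
    exact Subtype.ext hga

lemma quotEquiv_mk (q : QuadraticForm F2 V) (a : V) (g : V ≃ₗ[F2] V)
    (hg : ∀ x, q (g x) = q x) (hga : g a = a) (x : aperp q a) :
    quotEquiv q a g hg hga (Submodule.Quotient.mk x) =
      Submodule.Quotient.mk ⟨g x, map_mem_aperp hg hga x.2⟩ := rfl

/-- The bilinear form on `a^⊥ / ⟨a⟩` induced by the polar form of `q`. -/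
def quotBilin (q : QuadraticForm F2 V) (a : V) : QuotA q a →ₗ[F2] QuotA q a →ₗ[F2] F2 :=
  LinearMap.liftQ₂ (lineA q a) (lineA q a) (q.polarBilin.domRestrict₁₂ (aperp q a) (aperp q a))
    (by
      intro x hx
      ext y
      change polar q (x : V) y = 0
      rcases mem_lineA.1 hx with h | h <;> rw [h]
      · exact polar_zero_left q _
      · exact (polar_comm q a y).trans y.2)
    (by
      intro y hy
      ext x
      change polar q (x : V) y = 0
      rcases mem_lineA.1 hy with h | h <;> rw [h]
      · exact polar_zero_right q _
      · exact x.2)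

lemma quotBilin_mk (q : QuadraticForm F2 V) (a : V) (x y : aperp q a) :
    quotBilin q a (Submodule.Quotient.mk x) (Submodule.Quotient.mk y) =
      polar q (x : V) (y : V) := rfl

/-- The lift to `a^⊥` of a symplectic endomorphism of `a^⊥ / ⟨a⟩`. -/
lemma exists_lift_aperp {q : QuadraticForm F2 V} {a : V} (ha : q a = 1)
    (τ : QuotA q a →ₗ[F2] QuotA q a)
    (hτ : ∀ u w, quotBilin q a (τ u) (τ w) = quotBilin q a u w) :
    ∃ f : aperp q a →ₗ[F2] aperp q a,
      (∀ x, (Submodule.Quotient.mk (f x) : QuotA q a) = τ (Submodule.Quotient.mk x)) ∧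
      ∀ x, q (f x : V) = q (x : V) := by
  choose f hfτ hfq using fun x : aperp q a =>
    exists_mk_eq ha (τ (Submodule.Quotient.mk x)) (q (x : V))
  have hadd : ∀ x y, f (x + y) = f x + f y := by
    intro x y
    refine eq_of_mk_eq ha ?_ ?_
    · rw [hfτ, Submodule.Quotient.mk_add, Submodule.Quotient.mk_add, hfτ, hfτ, map_add]
    · rw [hfq, Submodule.coe_add, Submodule.coe_add, map_add_eq, map_add_eq, hfq, hfq,
        ← quotBilin_mk, ← quotBilin_mk, hfτ, hfτ, hτ]
  exact ⟨(AddMonoidHom.mk' f hadd).toZModLinearMap 2, hfτ, hfq⟩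

lemma sum_signChar_polar [Fintype V] {q : QuadraticForm F2 V} {u v₀ : V}
    (h : polar q u v₀ = 1) : ∑ v, signChar (polar q u v) = 0 := by
  have h1 := Equiv.sum_comp (Equiv.addRight v₀) fun v => signChar (polar q u v)
  simp only [Equiv.coe_addRight, polar_add_right, h, signChar_add, ← Finset.sum_mul] at h1
  rw [show signChar 1 = -1 from rfl] at h1
  linarith

/-- The Gauss sum of a nonsingular quadratic form over `𝔽₂` does not vanish. -/
lemma sum_signChar_ne_zero [Fintype V] {q : QuadraticForm F2 V}
    (hnd : ∀ v : V, (∀ w : V, polar q v w = 0) → v = 0) : ∑ v, signChar (q v) ≠ 0 := by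
  classical
  intro h0
  have key : (∑ v, signChar (q v)) * ∑ v, signChar (q v) = Fintype.card V := by
    calc (∑ v, signChar (q v)) * ∑ v, signChar (q v)
        = ∑ v, ∑ u, signChar (q v) * signChar (q (u + v)) := by
          rw [Finset.sum_mul_sum]
          refine Finset.sum_congr rfl fun v _ => ?_
          exact (Equiv.sum_comp (Equiv.addRight v) fun w => signChar (q v) * signChar (q w)).symm
      _ = ∑ v, ∑ u, signChar (q u) * signChar (polar q u v) := by
          refine Finset.sum_congr rfl fun v _ => Finset.sum_congr rfl fun u _ => ?_
          rw [← signChar_add, ← signChar_add, map_add_eq]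
          congr 1
          generalize q u = s, q v = t, polar q u v = r
          revert s t r
          decide
      _ = ∑ u, signChar (q u) * ∑ v, signChar (polar q u v) := by
          rw [Finset.sum_comm]
          simp only [Finset.mul_sum]
      _ = signChar (q 0) * ∑ v, signChar (polar q 0 v) := by
          refine Finset.sum_eq_single _ (fun u _ hu => ?_) fun h => (h (Finset.mem_univ _)).elim
          obtain ⟨v₀, hv₀⟩ := exists_polar_eq_one hnd hu
          rw [sum_signChar_polar ((polar_comm q u v₀).trans hv₀), mul_zero]
      _ = Fintype.card V := by
          simp [signChar]
  rw [h0, zero_mul] at key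
  have := Fintype.card_pos (α := V)
  omega

/-- The form `v ↦ q v + b(v, a)` is not isometric to `q` when `a` is a root. -/
lemma not_forall_map_eq_add_polar [FiniteDimensional F2 V] {q : QuadraticForm F2 V}
    (hnd : ∀ v : V, (∀ w : V, polar q v w = 0) → v = 0) {a : V} (ha : q a = 1) (g : V ≃ V) :
    ¬ ∀ v, q (g v) = q v + polar q v a := by
  intro h
  have : Finite V := Module.finite_of_finite F2
  have : Fintype V := Fintype.ofFinite V
  refine sum_signChar_ne_zero hnd ?_
  have h1 := Equiv.sum_comp g fun v => signChar (q v)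
  have h2 := Equiv.sum_comp (Equiv.addRight a) fun v => signChar (q v)
  have h3 : ∀ v, signChar (q v + q a + polar q v a) = - signChar (q v + polar q v a) := by
    intro v
    rw [ha, signChar_add, signChar_add, signChar_add, show signChar 1 = -1 from rfl]
    ring
  simp only [h] at h1
  simp only [Equiv.coe_addRight, map_add_eq, h3, Finset.sum_neg_distrib] at h2
  linarith

lemma exists_polar_eq [FiniteDimensional F2 V] {q : QuadraticForm F2 V}
    (hnd : ∀ v : V, (∀ w : V, polar q v w = 0) → v = 0) (φ : V →ₗ[F2] F2) :
    ∃ f : V, ∀ v, polar q f v = φ v := by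
  have hinj : Function.Injective (q.polarBilin : V →ₗ[F2] Module.Dual F2 V) := by
    rw [injective_iff_map_eq_zero]
    exact fun v hv => hnd v fun w => LinearMap.congr_fun hv w
  obtain ⟨f, hf⟩ := (LinearMap.injective_iff_surjective_of_finrank_eq_finrank
    Subspace.dual_finrank_eq.symm).1 hinj φ
  exact ⟨f, fun v => LinearMap.congr_fun hf v⟩

/-- Witt's extension theorem for isometries of `a^⊥` fixing a root `a`. -/
lemma exists_extend_aperp [FiniteDimensional F2 V] {q : QuadraticForm F2 V}
    (hnd : ∀ v : V, (∀ w : V, polar q v w = 0) → v = 0) {a : V} (ha : q a = 1)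
    (σ : aperp q a ≃ₗ[F2] aperp q a) (hσ : ∀ x, q (σ x : V) = q (x : V)) :
    ∃ g : V ≃ₗ[F2] V, (∀ x, q (g x) = q x) ∧ ∀ x : aperp q a, g x = σ x := by
  have ha0 : a ≠ 0 := by
    rintro rfl
    simp at ha
  obtain ⟨e, he⟩ := exists_polar_eq_one hnd ha0
  let π : V →ₗ[F2] aperp q a :=
    (LinearMap.id + (q.polarBilin.flip a).smulRight e).codRestrict (aperp q a)
      fun v => add_smul_mem_aperp he v
  have hπ : ∀ v, (π v : V) = v + polar q v a • e := fun v => rfl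
  have hπx : ∀ x : aperp q a, π x = x := by
    intro x
    ext
    rw [hπ, mem_aperp.1 x.2, zero_smul, add_zero]
  obtain ⟨f, hf⟩ := exists_polar_eq hnd
    ((q.polarBilin e).comp ((aperp q a).subtype.comp (σ.symm.toLinearMap.comp π)))
  have hfσ : ∀ x : aperp q a, polar q f (σ x) = polar q e x := by
    intro x
    rw [hf]
    simp [hπx]
  let g₀ : V →ₗ[F2] V :=
    (aperp q a).subtype.comp (σ.toLinearMap.comp π) + (q.polarBilin.flip a).smulRight f
  have hg₀ : ∀ v, g₀ v = σ (π v) + polar q v a • f := fun v => rfl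
  have hg₀x : ∀ x : aperp q a, g₀ x = σ x := by
    intro x
    rw [hg₀, hπx, mem_aperp.1 x.2, zero_smul, add_zero]
  have hqg : ∀ v, q (g₀ v) = q v + polar q v a * (q f + q e) := by
    intro v
    have hv : v = π v + polar q v a • e := by rw [hπ, add_smul_add_smul]
    rw [hg₀]
    conv_rhs => rw [hv]
    rw [map_add_eq, map_add_eq q (π v : V), hσ, QuadraticMap.map_smul, QuadraticMap.map_smul,
      polar_smul_right, polar_smul_right, polar_comm q _ f, hfσ, polar_comm q _ e, ← hv]
    generalize polar q v a = c
    simp only [smul_eq_mul]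
    generalize q f = s, q e = t, q (π v : V) = r, polar q e (π v) = d
    revert c s t r d
    decide
  have hpol : ∀ v w, polar q (g₀ v) (g₀ w) = polar q v w := by
    intro v w
    rw [polar, ← map_add, hqg, hqg, hqg, polar_add_left, polar.eq_def q v w]
    ring
  have hinj : Function.Injective g₀ := by
    rw [injective_iff_map_eq_zero]
    intro v hv
    refine hnd v fun w => ?_
    rw [← hpol, hv, polar_zero_left]
  let g : V ≃ₗ[F2] V := LinearEquiv.ofInjectiveEndo g₀ hinj
  have hg : ∀ v, g v = g₀ v := fun v => rfl
  refine ⟨g, fun v => ?_, hg₀x⟩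
  rw [hg, hqg]
  rcases F2.eq_zero_or_one (q f + q e) with h | h
  · rw [h, mul_zero, add_zero]
  · refine (not_forall_map_eq_add_polar hnd ha g.toEquiv fun w => ?_).elim
    refine (hqg w).trans ?_
    rw [h, mul_one]

lemma quotEquiv_surjective [FiniteDimensional F2 V] {q : QuadraticForm F2 V}
    (hnd : ∀ v : V, (∀ w : V, polar q v w = 0) → v = 0) {a : V} (ha : q a = 1)
    (τ : QuotA q a ≃ₗ[F2] QuotA q a)
    (hτ : ∀ u w, quotBilin q a (τ u) (τ w) = quotBilin q a u w) :
    ∃ (g : V ≃ₗ[F2] V) (hg : ∀ x, q (g x) = q x) (hga : g a = a),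
      quotEquiv q a g hg hga = τ := by
  obtain ⟨f, hfτ, hfq⟩ := exists_lift_aperp ha τ.toLinearMap hτ
  have hfa : f ⟨a, self_mem_aperp q a⟩ = ⟨a, self_mem_aperp q a⟩ := by
    refine eq_of_mk_eq ha ?_ (hfq _)
    have h0 : (Submodule.Quotient.mk ⟨a, self_mem_aperp q a⟩ : QuotA q a) = 0 :=
      (Submodule.Quotient.mk_eq_zero _).2 (mem_lineA.2 (Or.inr rfl))
    rw [hfτ, h0, map_zero]
  have hinj : Function.Injective f := by
    intro x y hxy
    refine eq_of_mk_eq ha (τ.injective ?_) ?_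
    · exact (hfτ x).symm.trans ((congrArg _ hxy).trans (hfτ y))
    · rw [← hfq x, hxy, hfq]
  obtain ⟨g, hg, hgf⟩ := exists_extend_aperp hnd ha (LinearEquiv.ofInjectiveEndo f hinj) hfq
  have hga : g a = a := (hgf ⟨a, self_mem_aperp q a⟩).trans (congrArg Subtype.val hfa)
  refine ⟨g, hg, hga, LinearEquiv.ext fun u => ?_⟩
  obtain ⟨x, rfl⟩ := Submodule.Quotient.mk_surjective _ u
  rw [quotEquiv_mk]
  exact (congrArg _ (Subtype.ext (hgf x))).trans (hfτ x)

lemma quotEquiv_eq_refl_iff {q : QuadraticForm F2 V}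
    (hnd : ∀ v : V, (∀ w : V, polar q v w = 0) → v = 0) {a : V} (ha : q a = 1)
    (g : V ≃ₗ[F2] V) (hg : ∀ x, q (g x) = q x) (hga : g a = a) :
    quotEquiv q a g hg hga = LinearEquiv.refl F2 (QuotA q a) ↔
      (∀ x, g x = x) ∨ ∀ x : V, g x = x + polar q x a • a := by
  constructor
  · intro h
    have hfix : ∀ x ∈ aperp q a, g x = x := by
      intro x hx
      have h1 := LinearEquiv.congr_fun h (Submodule.Quotient.mk ⟨x, hx⟩)
      rw [quotEquiv_mk] at h1
      exact congrArg Subtype.val (eq_of_mk_eq ha h1 (hg x))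
    have ha0 : a ≠ 0 := by
      rintro rfl
      simp at ha
    obtain ⟨e, he⟩ := exists_polar_eq_one hnd ha0
    have hz : ∀ x ∈ aperp q a, polar q (g e - e) x = 0 := by
      intro x hx
      rw [polar_sub_left, sub_eq_zero]
      nth_rewrite 1 [← hfix x hx]
      exact polar_map (map_add g) hg e x
    have hge := eq_smul_of_polar_aperp hnd he hz
    rw [sub_eq_iff_eq_add'] at hge
    have hgv : ∀ v, g v = v + (polar q v a * polar q (g e - e) e) • a := by
      intro v
      have h1 := hfix _ (add_smul_mem_aperp he v)
      rw [map_add, map_smul, ← eq_sub_iff_add_eq] at h1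
      rw [h1]
      generalize polar q (g e - e) e = c at hge
      rw [hge, mul_smul, smul_add, sub_eq_add_neg, ← neg_one_smul F2,
        show (-1 : F2) = 1 from rfl, one_smul]
      rw [← add_assoc, add_smul_add_smul]
    rcases F2.eq_zero_or_one (polar q (g e - e) e) with h0 | h0
    · exact Or.inl fun v => by rw [hgv, h0, mul_zero, zero_smul, add_zero]
    · exact Or.inr fun v => by rw [hgv, h0, mul_one]
  · intro h
    refine LinearEquiv.ext fun u => ?_
    obtain ⟨x, rfl⟩ := Submodule.Quotient.mk_surjective _ u
    rw [quotEquiv_mk]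
    refine congrArg _ (Subtype.ext ?_)
    rcases h with h | h
    · exact h x
    · exact (h x).trans (by rw [mem_aperp.1 x.2, zero_smul, add_zero])

/-- for a root `a` of a nonsingular quadratic 𝔽₂-space `(V,q)`,
the polar form induces a nondegenerate alternating form `b̄` on `Q = a^⊥/⟨a⟩`; every
`g ∈ O(V,q)` fixing `a` preserves `a^⊥` and induces an automorphism of `Q` preserving
`b̄`, and the resulting group homomorphism `O(V,q)_a → Sp(Q,b̄)` is surjective with
kernel `{id, σ_a}`. -/
theorem statement4 (V : Type*) [AddCommGroup V] [Module F2 V] [FiniteDimensional F2 V]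
    (q : QuadraticForm F2 V)
    (hnd : ∀ v : V, (∀ w : V, QuadraticMap.polar (⇑q) v w = 0) → v = 0)
    (a : V) (ha : q a = 1) :
    ∃ bbar : QuotA q a →ₗ[F2] QuotA q a →ₗ[F2] F2,
      (∀ x y : ↥(aperp q a),
        bbar (Submodule.Quotient.mk x) (Submodule.Quotient.mk y) =
          QuadraticMap.polar (⇑q) (x : V) (y : V)) ∧
      (∀ u : QuotA q a, (∀ w, bbar u w = 0) → u = 0) ∧
      (∀ u : QuotA q a, bbar u u = 0) ∧
      -- every `g ∈ O(V,q)` fixing `a` preserves `a^⊥`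
      (∀ g : V ≃ₗ[F2] V, (∀ x, q (g x) = q x) → g a = a →
        ∀ x ∈ aperp q a, g x ∈ aperp q a) ∧
      ∃ Φ : (g : V ≃ₗ[F2] V) → (∀ x, q (g x) = q x) → g a = a →
              (QuotA q a ≃ₗ[F2] QuotA q a),
        -- `Φ g` is the automorphism of `Q` induced by `g`
        (∀ (g : V ≃ₗ[F2] V) (hg : ∀ x, q (g x) = q x) (hga : g a = a)
            (x : V) (hx : x ∈ aperp q a) (hx' : g x ∈ aperp q a),
          Φ g hg hga (Submodule.Quotient.mk ⟨x, hx⟩) =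
            Submodule.Quotient.mk ⟨g x, hx'⟩) ∧
        -- `Φ g` preserves `b̄`
        (∀ (g : V ≃ₗ[F2] V) (hg : ∀ x, q (g x) = q x) (hga : g a = a)
            (u w : QuotA q a),
          bbar (Φ g hg hga u) (Φ g hg hga w) = bbar u w) ∧
        -- `Φ` is a group homomorphism
        (∀ (g g' : V ≃ₗ[F2] V) (hg : ∀ x, q (g x) = q x) (hg' : ∀ x, q (g' x) = q x)
            (hga : g a = a) (hg'a : g' a = a)
            (hm : ∀ x, q ((g * g') x) = q x) (hma : (g * g') a = a),
          Φ (g * g') hm hma = Φ g hg hga * Φ g' hg' hg'a) ∧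
        -- `Φ` is surjective onto `Sp(Q, b̄)`
        (∀ τ : QuotA q a ≃ₗ[F2] QuotA q a,
          (∀ u w, bbar (τ u) (τ w) = bbar u w) →
          ∃ (g : V ≃ₗ[F2] V) (hg : ∀ x, q (g x) = q x) (hga : g a = a),
            Φ g hg hga = τ) ∧
        -- the kernel of `Φ` is `{id, σ_a}`
        (∀ (g : V ≃ₗ[F2] V) (hg : ∀ x, q (g x) = q x) (hga : g a = a),
          Φ g hg hga = LinearEquiv.refl F2 (QuotA q a) ↔
            ((∀ x, g x = x) ∨
              (∀ x : V, g x = x + QuadraticMap.polar (⇑q) x a • a))) := by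
  have ha0 : a ≠ 0 := by
    rintro rfl
    simp at ha
  obtain ⟨e, he⟩ := exists_polar_eq_one hnd ha0
  refine ⟨quotBilin q a, quotBilin_mk q a, ?_, ?_, fun g hg hga x hx => map_mem_aperp hg hga hx,
    quotEquiv q a, ?_, ?_, ?_, quotEquiv_surjective hnd ha, quotEquiv_eq_refl_iff hnd ha⟩
  · intro u hu
    obtain ⟨x, rfl⟩ := Submodule.Quotient.mk_surjective _ u
    have hx := eq_smul_of_polar_aperp hnd he (z := x) fun y hy => hu (Submodule.Quotient.mk ⟨y, hy⟩)
    rw [Submodule.Quotient.mk_eq_zero, mem_lineA]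
    rcases F2.eq_zero_or_one (polar q x e) with h | h
    · exact Or.inl (by rwa [h, zero_smul] at hx)
    · exact Or.inr (by rwa [h, one_smul] at hx)
  · intro u
    obtain ⟨x, rfl⟩ := Submodule.Quotient.mk_surjective _ u
    exact polar_self_eq_zero q (x : V)
  · intro g hg hga x hx hx'
    rfl
  · intro g hg hga u w
    obtain ⟨x, rfl⟩ := Submodule.Quotient.mk_surjective _ u
    obtain ⟨y, rfl⟩ := Submodule.Quotient.mk_surjective _ w
    exact polar_map (map_add g) hg (x : V) (y : V)
  · intro g g' hg hg' hga hg'a hm hma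
    refine LinearEquiv.ext fun u => ?_
    obtain ⟨x, rfl⟩ := Submodule.Quotient.mk_surjective _ u
    rfl
end

section
/- The Eisenstein lattice L₅ is degenerate: det G₅ = 0. Moreover, for every integer n ≥ 0, the lattice L₆₊ₙ is isomorphic to L₄ ⊥ 𝓗 ⊥ Lₙ: there exists a (6+n)×(6+n) matrix U over 𝓔, invertible over 𝓔, such that Uᴴ G₆₊ₙ U is the block diagonal matrix diag(G₄, G_H, Gₙ) (for n = 0 read diag(G₄, G_H)). -/
open Matrix

/-- `ω = (−1+√−3)/2`, a primitive cube root of unity in `ℂ`. -/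
noncomputable def ω : ℂ := (-1 + Complex.I * Real.sqrt 3) / 2

/-- `θ = ω − ω̄ = √−3`. -/
noncomputable def θ : ℂ := Complex.I * Real.sqrt 3

/-- The ring `𝓔 = ℤ[ω]` of Eisenstein integers, as a subring of `ℂ`. -/
def Eis : Subring ℂ := Subring.closure {ω}

/-- The Gram matrix `Gₙ` of the Eisenstein lattice `Lₙ`: diagonal entries `3`, entries
`θ` and `−θ` next to the diagonal, `0` elsewhere. -/
noncomputable def Gm (n : ℕ) : Matrix (Fin n) (Fin n) ℂ :=
  Matrix.of fun i j =>
    if i = j then 3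
    else if (i : ℕ) + 1 = (j : ℕ) then θ
    else if (j : ℕ) + 1 = (i : ℕ) then -θ
    else 0

/-- The Gram matrix of the hyperbolic Eisenstein lattice `𝓗`. -/
noncomputable def GH : Matrix (Fin 2) (Fin 2) ℂ := !![0, θ; -θ, 0]

/-- A matrix has all its entries in `𝓔`. -/
def EisEntries {m n : Type*} (U : Matrix m n ℂ) : Prop := ∀ i j, U i j ∈ Eis

/-- A (possibly rectangular) matrix is invertible over `𝓔`: it has a two-sided inverse
with entries in `𝓔`. -/
def EisInvertible {m n : Type*} [Fintype m] [Fintype n] [DecidableEq m] [DecidableEq n]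
    (U : Matrix m n ℂ) : Prop :=
  EisEntries U ∧ ∃ W : Matrix n m ℂ, EisEntries W ∧ U * W = 1 ∧ W * U = 1

theorem theta_mul_self : θ * θ = -3 := by
  have h : ((Real.sqrt 3 : ℝ) : ℂ) * (Real.sqrt 3 : ℝ) = 3 := by
    rw [← Complex.ofReal_mul, Real.mul_self_sqrt (by norm_num)]
    norm_num
  unfold θ
  linear_combination Complex.I_mul_I * 3 + Complex.I * Complex.I * h

theorem theta_eq : θ = 2 * ω + 1 := by
  unfold θ ω
  ring

theorem star_theta : star θ = -θ := by
  simp [θ]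

theorem star_omega : star ω = -1 - ω := by
  simp [ω]
  ring

theorem omega_mem : ω ∈ Eis := Subring.subset_closure rfl

theorem theta_mem : θ ∈ Eis := by
  rw [theta_eq, two_mul]
  exact add_mem (add_mem omega_mem omega_mem) (one_mem _)

theorem det_Gm_five : (Gm 5).det = 0 := by
  have hθ := theta_mul_self
  refine Matrix.exists_mulVec_eq_zero_iff.mp ⟨![1, θ, -2, -θ, 1], fun h => ?_, ?_⟩
  · simpa using congrFun h 0
  · ext i
    fin_cases i <;> simp [Gm, Matrix.mulVec, dotProduct, Fin.sum_univ_succ] <;> grind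

/-- The index set of `L₆₊ₙ`, split according to `L₄`, `𝓗` and `Lₙ`. -/
def splitIndex (n : ℕ) : Fin 4 ⊕ (Fin 2 ⊕ Fin n) ≃ Fin (6 + n) :=
  (Equiv.sumAssoc (Fin 4) (Fin 2) (Fin n)).symm.trans
    ((Equiv.sumCongr finSumFinEquiv (Equiv.refl (Fin n))).trans finSumFinEquiv)

@[simp] theorem splitIndex_inl (n : ℕ) (i : Fin 4) :
    (splitIndex n (.inl i) : ℕ) = i := rfl

@[simp] theorem splitIndex_inr_inl (n : ℕ) (i : Fin 2) :
    (splitIndex n (.inr (.inl i)) : ℕ) = 4 + i := rfl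

@[simp] theorem splitIndex_inr_inr (n : ℕ) (i : Fin n) :
    (splitIndex n (.inr (.inr i)) : ℕ) = 6 + i := rfl

theorem isHermitian_Gm (n : ℕ) : (Gm n).IsHermitian := by
  ext i j
  simp only [conjTranspose_apply, Gm, of_apply, Fin.ext_iff]
  split_ifs <;> first | omega | simp [star_theta]

/-- The fifth basis vector of `L₆₊ₙ`. -/
noncomputable def fifthVec (n : ℕ) : Fin (6 + n) → ℂ := Pi.single (Fin.castAdd n 4) 1

/-- The sixth basis vector of `L₆₊ₙ`. -/
noncomputable def sixthVec (n : ℕ) : Fin (6 + n) → ℂ := Pi.single (Fin.castAdd n 5) 1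

/-- The isotropic vector of `L₅ ⊂ L₆₊ₙ` whose fifth coordinate is `1`. -/
noncomputable def isotropicVec (n : ℕ) : Fin (6 + n) → ℂ := Fin.append ![1, θ, -2, -θ, 1, 0] 0

/-- The multiples of `isotropicVec` to be added in the change of basis. -/
noncomputable def isotropicShift (n : ℕ) : Fin (6 + n) → ℂ :=
  Fin.append ![0, 0, 0, 0, 1, -ω] fun j => if (j : ℕ) = 0 then 1 else 0

/-- The change of basis whose columns are `e₁, …, e₄, z, e₆ - ω z, e₇ + z, e₈, …`, with `z` the
isotropic vector of `L₅`. -/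
noncomputable def splitBasis (n : ℕ) : Matrix (Fin (6 + n)) (Fin (6 + n)) ℂ :=
  1 - vecMulVec (fifthVec n) (fifthVec n) + vecMulVec (isotropicVec n) (isotropicShift n)

/-- The inverse of `splitBasis`. -/
noncomputable def splitBasisInv (n : ℕ) : Matrix (Fin (6 + n)) (Fin (6 + n)) ℂ :=
  1 - vecMulVec (isotropicVec n) (fifthVec n) +
    vecMulVec (fifthVec n) (fifthVec n + fifthVec n - isotropicShift n)

theorem eisEntries_one {m : Type*} [DecidableEq m] : EisEntries (1 : Matrix m m ℂ) := by
  intro i j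
  rw [Matrix.one_apply]
  split_ifs
  exacts [one_mem _, zero_mem _]

theorem fifthVec_mem (n : ℕ) (i : Fin (6 + n)) : fifthVec n i ∈ Eis := by
  rw [fifthVec, Pi.single_apply]
  split_ifs
  exacts [one_mem _, zero_mem _]

theorem isotropicVec_mem (n : ℕ) (i : Fin (6 + n)) : isotropicVec n i ∈ Eis := by
  induction i using Fin.addCases with
  | left i =>
    rw [isotropicVec, Fin.append_left]
    fin_cases i <;> simp [theta_mem, one_mem, zero_mem]
  | right i => simp [isotropicVec, zero_mem]

theorem isotropicShift_mem (n : ℕ) (i : Fin (6 + n)) : isotropicShift n i ∈ Eis := by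
  induction i using Fin.addCases with
  | left i =>
    rw [isotropicShift, Fin.append_left]
    fin_cases i <;> simp [omega_mem, one_mem, zero_mem]
  | right i =>
    rw [isotropicShift, Fin.append_right]
    split_ifs
    exacts [one_mem _, zero_mem _]

theorem eisEntries_splitBasis (n : ℕ) : EisEntries (splitBasis n) := fun i j =>
  add_mem (sub_mem (eisEntries_one i j) (mul_mem (fifthVec_mem n i) (fifthVec_mem n j)))
    (mul_mem (isotropicVec_mem n i) (isotropicShift_mem n j))

theorem eisEntries_splitBasisInv (n : ℕ) : EisEntries (splitBasisInv n) := fun i j =>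
  add_mem (sub_mem (eisEntries_one i j) (mul_mem (isotropicVec_mem n i) (fifthVec_mem n j)))
    (mul_mem (fifthVec_mem n i)
      (sub_mem (add_mem (fifthVec_mem n j) (fifthVec_mem n j)) (isotropicShift_mem n j)))

theorem fifthVec_dotProduct_fifthVec (n : ℕ) : fifthVec n ⬝ᵥ fifthVec n = 1 := by
  simp [fifthVec]

theorem fifthVec_dotProduct_isotropicVec (n : ℕ) : fifthVec n ⬝ᵥ isotropicVec n = 1 := by
  simp [fifthVec, isotropicVec, Fin.append_left]

theorem isotropicShift_dotProduct_fifthVec (n : ℕ) : isotropicShift n ⬝ᵥ fifthVec n = 1 := by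
  simp [fifthVec, isotropicShift, Fin.append_left]

theorem isotropicShift_dotProduct_isotropicVec (n : ℕ) :
    isotropicShift n ⬝ᵥ isotropicVec n = 1 := by
  simp [dotProduct, isotropicShift, isotropicVec, Fin.sum_univ_add, Fin.sum_univ_succ]

theorem splitBasis_mul_inv (n : ℕ) : splitBasis n * splitBasisInv n = 1 := by
  simp only [splitBasis, splitBasisInv, add_mul, sub_mul, mul_add, mul_sub, one_mul, mul_one,
    vecMulVec_mul_vecMulVec, fifthVec_dotProduct_fifthVec, fifthVec_dotProduct_isotropicVec,
    isotropicShift_dotProduct_fifthVec, isotropicShift_dotProduct_isotropicVec, one_smul,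
    vecMulVec_add, vecMulVec_sub]
  abel

theorem Gm_mulVec_isotropicVec (n : ℕ) :
    Gm (6 + n) *ᵥ isotropicVec n = -θ • sixthVec n := by
  have hθ := theta_mul_self
  ext i
  obtain ⟨i, rfl⟩ := (splitIndex n).surjective i
  simp only [Matrix.mulVec, dotProduct, Fin.sum_univ_add, isotropicVec, Fin.append_left,
    Fin.append_right, Fin.sum_univ_six, sixthVec, Gm, of_apply, Fin.ext_iff, Pi.smul_apply,
    Pi.single_apply]
  rcases i with i | i | i
  · fin_cases i <;> simp <;> grind
  · fin_cases i
    · simp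
      grind
    · simp
  · simp
    grind

theorem star_isotropicVec_vecMul_Gm (n : ℕ) :
    star (isotropicVec n) ᵥ* Gm (6 + n) = θ • sixthVec n := by
  rw [← (isHermitian_Gm (6 + n)).eq, ← star_mulVec, Gm_mulVec_isotropicVec, star_smul, star_neg,
    star_theta, neg_neg, sixthVec, Pi.star_single, star_one]

theorem sixthVec_dotProduct_isotropicVec (n : ℕ) : sixthVec n ⬝ᵥ isotropicVec n = 0 := by
  simp [sixthVec, isotropicVec, Fin.append_left]

theorem one_sub_vecMulVec_fifthVec (n : ℕ) :
    1 - vecMulVec (fifthVec n) (fifthVec n) = diagonal (1 - fifthVec n) := by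
  rw [fifthVec, ← single_eq_single_vecMulVec_single, ← diagonal_single, ← diagonal_one,
    diagonal_sub]
  rfl

theorem splitBasis_gram_apply (n : ℕ) (i j : Fin (6 + n)) :
    ((splitBasis n)ᴴ * Gm (6 + n) * splitBasis n) i j =
      (1 - fifthVec n i) * Gm (6 + n) i j * (1 - fifthVec n j) -
        θ * (sixthVec n i * isotropicShift n j) +
        θ * (star (isotropicShift n i) * sixthVec n j) := by
  have hd : (diagonal (1 - fifthVec n))ᴴ = diagonal (1 - fifthVec n) := by
    rw [diagonal_conjTranspose, star_sub, star_one, fifthVec, Pi.star_single, star_one]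
  have hs : diagonal (1 - fifthVec n) *ᵥ sixthVec n = sixthVec n := by
    simp [sixthVec, fifthVec, Fin.ext_iff]
  have hs' : sixthVec n ᵥ* diagonal (1 - fifthVec n) = sixthVec n := by
    simp [sixthVec, fifthVec, Fin.ext_iff]
  have h : (splitBasis n)ᴴ * Gm (6 + n) * splitBasis n =
      diagonal (1 - fifthVec n) * Gm (6 + n) * diagonal (1 - fifthVec n) -
        θ • vecMulVec (sixthVec n) (isotropicShift n) +
        θ • vecMulVec (star (isotropicShift n)) (sixthVec n) := by
    simp only [splitBasis, one_sub_vecMulVec_fifthVec, conjTranspose_add, hd,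
      conjTranspose_vecMulVec, add_mul, mul_add, vecMulVec_mul, mul_vecMulVec, ← mulVec_mulVec,
      Gm_mulVec_isotropicVec, star_isotropicVec_vecMul_Gm, smul_vecMul, mulVec_smul, hs, hs',
      vecMulVec_mulVec, smul_dotProduct, sixthVec_dotProduct_isotropicVec]
    simp [smul_vecMulVec, vecMulVec_smul]
    abel
  rw [h]
  simp [mul_diagonal, diagonal_mul, vecMulVec_apply]

/-- The Gram matrix of the basis `splitBasis`. -/
theorem splitBasis_gram (n : ℕ) :
    ((splitBasis n)ᴴ * Gm (6 + n) * splitBasis n).submatrix (splitIndex n) (splitIndex n) =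
      Matrix.fromBlocks (Gm 4) 0 0 (Matrix.fromBlocks GH 0 0 (Gm n)) := by
  have hinl (i : Fin 4) : splitIndex n (.inl i) = Fin.castAdd n (Fin.castAdd 2 i) := rfl
  have hinr (i : Fin 2) : splitIndex n (.inr (.inl i)) = Fin.castAdd n (Fin.natAdd 4 i) := rfl
  have hinr' (i : Fin n) : splitIndex n (.inr (.inr i)) = Fin.natAdd 6 i := rfl
  have hθ := theta_mul_self
  have hω := theta_eq
  ext i j
  rw [submatrix_apply, splitBasis_gram_apply]
  rcases i with i | i | i <;> rcases j with j | j | j <;>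
    simp only [fromBlocks_apply₁₁, fromBlocks_apply₁₂, fromBlocks_apply₂₁, fromBlocks_apply₂₂,
      hinl, hinr, hinr', fifthVec, sixthVec, isotropicShift, Fin.append_left, Fin.append_right,
      Pi.single_apply, Gm, of_apply, Fin.ext_iff, Fin.val_castAdd, Fin.val_natAdd]
  all_goals
    try fin_cases i
    all_goals
      try fin_cases j
      all_goals
        simp [GH, star_omega]
        try grind

/-- Statement 13: `L₅` is degenerate (`det G₅ = 0`), and for every `n ≥ 0`,
`L₆₊ₙ ≅ L₄ ⊥ 𝓗 ⊥ Lₙ`. -/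
theorem statement13 :
    (Gm 5).det = 0 ∧
    ∀ n : ℕ, ∃ U : Matrix (Fin (6 + n)) (Fin 4 ⊕ (Fin 2 ⊕ Fin n)) ℂ,
      EisInvertible U ∧
      Uᴴ * Gm (6 + n) * U =
        Matrix.fromBlocks (Gm 4) 0 0 (Matrix.fromBlocks GH 0 0 (Gm n)) := by
  refine ⟨det_Gm_five, fun n => ⟨(splitBasis n).submatrix (Equiv.refl _) (splitIndex n),
    ⟨fun i j => eisEntries_splitBasis n _ _,
      (splitBasisInv n).submatrix (splitIndex n) (Equiv.refl _),
      fun i j => eisEntries_splitBasisInv n _ _, ?_, ?_⟩, ?_⟩⟩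
  · rw [Matrix.submatrix_mul_equiv, splitBasis_mul_inv, Matrix.submatrix_one_equiv]
  · rw [Matrix.submatrix_mul_equiv, _root_.mul_eq_one_comm.mp (splitBasis_mul_inv n),
      Matrix.submatrix_one_equiv]
  · rw [← splitBasis_gram]
    rfl
end

section
/- The Eisenstein lattice L₃ ⊥ 𝓗 is isomorphic to L₄ ⊥ L₁(−1): there exists a 5×5 matrix U over 𝓔, invertible over 𝓔, such that Uᴴ · diag(G₃, G_H) · U = diag(G₄, [−3]). -/
open Matrix

theorem ω_sq : ω ^ 2 = -1 - ω := by
  have h : ((Real.sqrt 3 : ℝ) : ℂ) ^ 2 = 3 := by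
    rw [← Complex.ofReal_pow, Real.sq_sqrt (by norm_num)]
    norm_num
  unfold ω
  linear_combination (1 / 4 : ℂ) * (Real.sqrt 3 : ℂ) ^ 2 * Complex.I_sq - (1 / 4 : ℂ) * h

theorem θ_eq : θ = 1 + 2 * ω := by
  unfold θ ω
  ring

theorem star_ω : (starRingEnd ℂ) ω = -1 - ω := by
  simp only [ω, map_div₀, map_add, map_neg, map_one, map_mul, Complex.conj_I,
    Complex.conj_ofReal, map_ofNat]
  ring

theorem add_mul_ω_mem_Eis (a b : ℤ) : (a : ℂ) + b * ω ∈ Eis :=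
  add_mem (intCast_mem _ a) (mul_mem (intCast_mem _ b) (Subring.subset_closure rfl))

/-- The complex matrix with entries `a + bω`, given by integral matrices of the `a` and `b`. -/
noncomputable def eisMatrix {m n : Type*} (A B : Matrix m n ℤ) : Matrix m n ℂ :=
  Matrix.of fun i j => (A i j : ℂ) + B i j * ω

theorem eisEntries_eisMatrix {m n : Type*} (A B : Matrix m n ℤ) : EisEntries (eisMatrix A B) :=
  fun i j => add_mul_ω_mem_Eis (A i j) (B i j)

/-- `(A + Bω)(C + Dω) = (AC - BD) + (AD + BC - BD)ω`. -/
theorem eisMatrix_mul {l m n : Type*} [Fintype m] (A B : Matrix l m ℤ) (C D : Matrix m n ℤ) :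
    eisMatrix A B * eisMatrix C D = eisMatrix (A * C - B * D) (A * D + B * C - B * D) := by
  ext i j
  simp only [eisMatrix, Matrix.mul_apply, Matrix.of_apply, Matrix.sub_apply, Matrix.add_apply,
    Int.cast_sub, Int.cast_add, Int.cast_sum, Int.cast_mul, ← Finset.sum_sub_distrib,
    ← Finset.sum_add_distrib, Finset.sum_mul]
  refine Finset.sum_congr rfl fun k _ => ?_
  linear_combination (B i k : ℂ) * D k j * ω_sq

theorem eisMatrix_conjTranspose {m n : Type*} (A B : Matrix m n ℤ) :
    (eisMatrix A B)ᴴ = eisMatrix (Aᵀ - Bᵀ) (-Bᵀ) := by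
  ext i j
  simp [eisMatrix, star_ω]
  ring

theorem eisMatrix_one {n : Type*} [DecidableEq n] : eisMatrix (1 : Matrix n n ℤ) 0 = 1 := by
  ext i j
  by_cases h : i = j <;> simp [eisMatrix, Matrix.one_apply, h]

theorem fromBlocks_Gm_GH : Matrix.fromBlocks (Gm 3) 0 0 GH =
    eisMatrix
      (Matrix.fromBlocks !![3, 1, 0; -1, 3, 1; 0, -1, 3] 0 0 !![0, 1; -1, 0])
      (Matrix.fromBlocks !![0, 2, 0; -2, 0, 2; 0, -2, 0] 0 0 !![0, 2; -2, 0]) := by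
  ext i j
  rcases i with i | i <;> rcases j with j | j <;> fin_cases i <;> fin_cases j <;>
    simp [eisMatrix, Gm, GH, θ_eq] <;> ring

theorem fromBlocks_Gm_neg_three : Matrix.fromBlocks (Gm 4) 0 0 !![(-3 : ℂ)] =
    eisMatrix
      (Matrix.fromBlocks !![3, 1, 0, 0; -1, 3, 1, 0; 0, -1, 3, 1; 0, 0, -1, 3] 0 0 !![-3])
      (Matrix.fromBlocks !![0, 2, 0, 0; -2, 0, 2, 0; 0, -2, 0, 2; 0, 0, -2, 0] 0 0 !![0]) := by
  ext i j
  rcases i with i | i <;> rcases j with j | j <;> fin_cases i <;> fin_cases j <;>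
    simp [eisMatrix, Gm, θ_eq] <;> ring

/-- Statement 15: `L₃ ⊥ 𝓗 ≅ L₄ ⊥ L₁(−1)`. -/
theorem statement15 :
    ∃ U : Matrix (Fin 3 ⊕ Fin 2) (Fin 4 ⊕ Fin 1) ℂ,
      EisInvertible U ∧
      Uᴴ * Matrix.fromBlocks (Gm 3) 0 0 GH * U =
        Matrix.fromBlocks (Gm 4) 0 0 !![(-3 : ℂ)] := by
  refine ⟨eisMatrix
    (Matrix.fromBlocks
      !![0, 0, 0, -1; 1, 0, 0, 0; 0, 1, 0, 1] !![1; 0; 1]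
      !![0, 0, 1, 1; 0, -1, -1, 0] !![1; -2])
    (Matrix.fromBlocks
      !![0, 0, 0, -1; 0, 0, 0, -1; 0, 0, 0, 0] !![0; 0; 0]
      !![0, 0, 0, 1; 0, 0, -1, 0] !![2; -1]),
    ⟨eisEntries_eisMatrix _ _, eisMatrix
      (Matrix.fromBlocks
        !![-2, 1, -1; 1, 0, 2; 3, 0, 2; 0, 0, 0] !![0, -1; 2, 1; 1, 2; -1, 0]
        !![-1, 0, -1] !![-1, -1])
      (Matrix.fromBlocks
        !![-2, 0, -1; -2, 0, -1; 2, 0, 2; 2, 0, 1] !![-1, -1; 1, -1; 2, 2; 0, 1]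
        !![0, 0, 0] !![-1, 0]),
      eisEntries_eisMatrix _ _, ?_, ?_⟩, ?_⟩
  · rw [eisMatrix_mul, ← eisMatrix_one]
    congr 1 <;> decide
  · rw [eisMatrix_mul, ← eisMatrix_one]
    congr 1 <;> decide
  · rw [fromBlocks_Gm_GH, fromBlocks_Gm_neg_three, eisMatrix_conjTranspose, eisMatrix_mul,
      eisMatrix_mul]
    congr 1 <;> decide
end

section
/- Consider V := 𝔽₃⁴ with the quadratic form Q(x) = x₁² + x₂² + x₃² + x₄² and the bilinear form B(x, y) = ∑ᵢ xᵢ yᵢ. Then: (i) there exists a 2-dimensional subspace I ⊆ V with Q identically zero on I; (ii) every such totally isotropic 2-dimensional subspace I satisfies I = I^⊥, where I^⊥ := {y ∈ V : B(x, y) = 0 for all x ∈ I}; and (iii) the group of signed permutations of V acts transitively on the set of totally isotropic 2-dimensional subspaces. -/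
/-- The quadratic form `Q(x) = x₁² + x₂² + x₃² + x₄²` on `𝔽₃⁴`. -/
def Q3 (x : Fin 4 → ZMod 3) : ZMod 3 := ∑ i, x i ^ 2

/-- The bilinear form `B(x,y) = ∑ᵢ xᵢ yᵢ` on `𝔽₃⁴`. -/
def B3 (x y : Fin 4 → ZMod 3) : ZMod 3 := ∑ i, x i * y i

/-- The signed permutation `x ↦ (ε₁ x_{π(1)}, …, ε₄ x_{π(4)})` of `𝔽₃⁴`, as a linear
map. -/
def signedPerm (ε : Fin 4 → ZMod 3) (π : Equiv.Perm (Fin 4)) :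
    (Fin 4 → ZMod 3) →ₗ[ZMod 3] (Fin 4 → ZMod 3) where
  toFun := fun x i => ε i * x (π i)
  map_add' := by
    intro x y
    funext i
    simp [mul_add]
  map_smul' := by
    intro c x
    funext i
    simp only [Pi.smul_apply, smul_eq_mul, RingHom.id_apply]
    ring

/-- The projection of `𝔽₃⁴` to its first two coordinates. -/
def firstTwo : (Fin 4 → ZMod 3) →ₗ[ZMod 3] (Fin 2 → ZMod 3) :=
  LinearMap.funLeft (ZMod 3) (ZMod 3) ![0, 1]

lemma eq_zero_of_sq_add_sq_eq_zero : ∀ a b : ZMod 3, a ^ 2 + b ^ 2 = 0 → a = 0 ∧ b = 0 := by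
  decide

lemma sq_eq_one_of_one_add_sq_add_sq_eq_zero :
    ∀ a b : ZMod 3, 1 + a ^ 2 + b ^ 2 = 0 → a ^ 2 = 1 ∧ b ^ 2 = 1 := by
  decide

/-- A vector of a totally isotropic subspace is determined by its first two coordinates. -/
lemma injective_firstTwo_of_isotropic (I : Submodule (ZMod 3) (Fin 4 → ZMod 3))
    (hQ : ∀ x ∈ I, Q3 x = 0) : Function.Injective (firstTwo.domRestrict I) := by
  rw [← LinearMap.ker_eq_bot, LinearMap.ker_eq_bot']
  rintro ⟨x, hx⟩ h
  have h0 : x 0 = 0 := congrFun h 0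
  have h1 : x 1 = 0 := congrFun h 1
  have hq := hQ x hx
  simp only [Q3, Fin.sum_univ_four, h0, h1] at hq
  obtain ⟨h2, h3⟩ := eq_zero_of_sq_add_sq_eq_zero (x 2) (x 3) (by linear_combination hq)
  ext i
  fin_cases i <;> simp [h0, h1, h2, h3]

/-- Every totally isotropic plane is the graph of a linear map with entries `±1`. -/
lemma exists_graph_of_isotropic (I : Submodule (ZMod 3) (Fin 4 → ZMod 3))
    (hI : Module.finrank (ZMod 3) ↥I = 2) (hQ : ∀ x ∈ I, Q3 x = 0) :
    ∃ p q r : ZMod 3, p ^ 2 = 1 ∧ q ^ 2 = 1 ∧ r ^ 2 = 1 ∧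
      ∀ x, x ∈ I ↔ x 2 = p * x 0 + r * x 1 ∧ x 3 = q * x 0 - p * q * r * x 1 := by
  have hinj := injective_firstTwo_of_isotropic I hQ
  have hsurj : Function.Surjective (firstTwo.domRestrict I) :=
    (LinearMap.injective_iff_surjective_of_finrank_eq_finrank (by simp [hI])).1 hinj
  obtain ⟨⟨u, hu⟩, hu'⟩ := hsurj ![1, 0]
  obtain ⟨⟨v, hv⟩, hv'⟩ := hsurj ![0, 1]
  have hu0 : u 0 = 1 := congrFun hu' 0
  have hu1 : u 1 = 0 := congrFun hu' 1
  have hv0 : v 0 = 0 := congrFun hv' 0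
  have hv1 : v 1 = 1 := congrFun hv' 1
  have hqu := hQ u hu
  have hqv := hQ v hv
  have hquv := hQ (u - v) (I.sub_mem hu hv)
  simp only [Q3, Fin.sum_univ_four, Pi.sub_apply, hu0, hu1, hv0, hv1] at hqu hqv hquv
  obtain ⟨hp, hq⟩ :=
    sq_eq_one_of_one_add_sq_add_sq_eq_zero (u 2) (u 3) (by linear_combination hqu)
  obtain ⟨hr, -⟩ :=
    sq_eq_one_of_one_add_sq_add_sq_eq_zero (v 2) (v 3) (by linear_combination hqv)
  have h3 : (3 : ZMod 3) = 0 := rfl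
  have horth : u 2 * v 2 + u 3 * v 3 = 0 := by
    linear_combination hquv - hqu - hqv + (u 2 * v 2 + u 3 * v 3) * h3
  have hs : v 3 = -(u 2 * u 3 * v 2) := by
    linear_combination u 3 * horth - v 3 * hq
  have hcomb (x : Fin 4 → ZMod 3) : x 0 • u + x 1 • v ∈ I :=
    I.add_mem (I.smul_mem _ hu) (I.smul_mem _ hv)
  refine ⟨u 2, u 3, v 2, hp, hq, hr, fun x => ⟨fun hx => ?_, fun ⟨h2, h3⟩ => ?_⟩⟩
  · have hxe : x = x 0 • u + x 1 • v := by
      refine congrArg Subtype.val (@hinj ⟨x, hx⟩ ⟨_, hcomb x⟩ ?_)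
      ext i
      fin_cases i <;> simp [firstTwo, LinearMap.funLeft_apply, hu0, hu1, hv0, hv1]
    have h2 := congrFun hxe 2
    have h3 := congrFun hxe 3
    simp only [Pi.add_apply, Pi.smul_apply, smul_eq_mul] at h2 h3
    exact ⟨by linear_combination h2, by linear_combination h3 + x 1 * hs⟩
  · have hxe : x = x 0 • u + x 1 • v := by
      ext i
      fin_cases i
      · simp [hu0, hv0]
      · simp [hu1, hv1]
      · simp [h2, mul_comm]
      · simp only [Fin.reduceFinMk, Pi.add_apply, Pi.smul_apply, smul_eq_mul]
        linear_combination h3 - x 1 * hs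
    rw [hxe]
    exact hcomb x

lemma exists_isotropic_plane :
    ∃ I : Submodule (ZMod 3) (Fin 4 → ZMod 3),
      Module.finrank (ZMod 3) ↥I = 2 ∧ ∀ x ∈ I, Q3 x = 0 := by
  let f : (Fin 2 → ZMod 3) →ₗ[ZMod 3] (Fin 4 → ZMod 3) :=
    Matrix.mulVecLin !![1, 0; 0, 1; 1, 1; 1, -1]
  have h3 : (3 : ZMod 3) = 0 := rfl
  refine ⟨LinearMap.range f, ?_, ?_⟩
  · rw [LinearMap.finrank_range_of_inj, Module.finrank_fin_fun]
    intro a b h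
    have h0 := congrFun h 0
    have h1 := congrFun h 1
    simp [f, Matrix.mulVec, dotProduct] at h0 h1
    ext i
    fin_cases i
    · exact h0
    · exact h1
  · rintro _ ⟨a, rfl⟩
    simp [f, Q3, Fin.sum_univ_four, Matrix.mulVec, dotProduct]
    linear_combination (a 0 ^ 2 + a 1 ^ 2) * h3

lemma isotropic_plane_eq_orthogonal (I : Submodule (ZMod 3) (Fin 4 → ZMod 3))
    (hI : Module.finrank (ZMod 3) ↥I = 2) (hQ : ∀ x ∈ I, Q3 x = 0) :
    (I : Set (Fin 4 → ZMod 3)) = {y | ∀ x ∈ I, B3 x y = 0} := by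
  obtain ⟨p, q, r, hp, hq, hr, hmem⟩ := exists_graph_of_isotropic I hI hQ
  ext y
  simp only [SetLike.mem_coe, Set.mem_ofPred_eq]
  constructor
  · intro hy x hx
    obtain ⟨hy2, hy3⟩ := (hmem y).1 hy
    obtain ⟨hx2, hx3⟩ := (hmem x).1 hx
    simp only [B3, Fin.sum_univ_four, hx2, hx3, hy2, hy3]
    grind
  · intro hy
    have hu := hy ![1, 0, p, q] ((hmem _).2 (by simp))
    have hv := hy ![0, 1, r, -(p * q * r)] ((hmem _).2 (by simp))
    simp [B3, Fin.sum_univ_four] at hu hv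
    rw [hmem]
    constructor <;> grind

lemma exists_signedPerm_map_eq (I J : Submodule (ZMod 3) (Fin 4 → ZMod 3))
    (hI : Module.finrank (ZMod 3) ↥I = 2) (hQI : ∀ x ∈ I, Q3 x = 0)
    (hJ : Module.finrank (ZMod 3) ↥J = 2) (hQJ : ∀ x ∈ J, Q3 x = 0) :
    ∃ (ε : Fin 4 → ZMod 3) (π : Equiv.Perm (Fin 4)),
      (∀ i, ε i = 1 ∨ ε i = -1) ∧ Submodule.map (signedPerm ε π) I = J := by
  obtain ⟨p, q, r, hp, hq, hr, hmemI⟩ := exists_graph_of_isotropic I hI hQI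
  obtain ⟨p', q', r', hp', hq', hr', hmemJ⟩ := exists_graph_of_isotropic J hJ hQJ
  let ε : Fin 4 → ZMod 3 := ![1, p * r * (p' * r'), p * p', q * q']
  have hε (i) : ε i ^ 2 = 1 := by
    fin_cases i <;> simp [ε, mul_pow, hp, hq, hr, hp', hq', hr']
  refine ⟨ε, 1, fun i => sq_eq_one_iff.1 (hε i), ?_⟩
  have hinv (x) : signedPerm ε 1 (signedPerm ε 1 x) = x := by
    ext i
    simp only [signedPerm, LinearMap.coe_mk, AddHom.coe_mk, Equiv.Perm.one_apply]
    linear_combination x i * hε i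
  have hcoord (x i) : signedPerm ε 1 x i = ε i * x i := rfl
  have hIJ (x) (hx : x ∈ I) : signedPerm ε 1 x ∈ J := by
    obtain ⟨h2, h3⟩ := (hmemI x).1 hx
    rw [hmemJ]
    simp only [hcoord, h2, h3]
    simp [ε]
    constructor <;> grind
  have hJI (x) (hx : x ∈ J) : signedPerm ε 1 x ∈ I := by
    obtain ⟨h2, h3⟩ := (hmemJ x).1 hx
    rw [hmemI]
    simp only [hcoord, h2, h3]
    simp [ε]
    constructor <;> grind
  ext x
  constructor
  · rintro ⟨y, hy, rfl⟩
    exact hIJ y hy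
  · exact fun hx => ⟨_, hJI x hx, hinv x⟩

/-- Statement 19: on `𝔽₃⁴` with `Q(x) = ∑ xᵢ²`: (i) there is a 2-dimensional totally
isotropic subspace `I`; (ii) every such `I` satisfies `I = I^⊥`; (iii) the group of
signed permutations acts transitively on the totally isotropic 2-dimensional
subspaces. -/
theorem statement19 :
    (∃ I : Submodule (ZMod 3) (Fin 4 → ZMod 3),
        Module.finrank (ZMod 3) ↥I = 2 ∧ ∀ x ∈ I, Q3 x = 0) ∧
    (∀ I : Submodule (ZMod 3) (Fin 4 → ZMod 3),
        Module.finrank (ZMod 3) ↥I = 2 → (∀ x ∈ I, Q3 x = 0) →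
        (I : Set (Fin 4 → ZMod 3)) = {y | ∀ x ∈ I, B3 x y = 0}) ∧
    (∀ I J : Submodule (ZMod 3) (Fin 4 → ZMod 3),
        Module.finrank (ZMod 3) ↥I = 2 → (∀ x ∈ I, Q3 x = 0) →
        Module.finrank (ZMod 3) ↥J = 2 → (∀ x ∈ J, Q3 x = 0) →
        ∃ (ε : Fin 4 → ZMod 3) (π : Equiv.Perm (Fin 4)),
          (∀ i, ε i = 1 ∨ ε i = -1) ∧
          Submodule.map (signedPerm ε π) I = J) := by
  exact ⟨exists_isotropic_plane, isotropic_plane_eq_orthogonal, exists_signedPerm_map_eq⟩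
end
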